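/- arXiv:2202.00656 — 9 statements merged into one kernel-verified Lean document; each statement's English description precedes it below -/
import Mathlib

section
/- Let G be an additive commutative group, let Λ ⊆ G, let 𝒜 ⊆ Λ be nonempty, and let S ⊆ G be a finite nonempty subset. Assume: (a) S ⊆ 𝔅_Λ, i.e. for every α ∈ S and every λ ∈ Λ the set {k ∈ ℤ_{>0} | λ + k·α ∈ Λ} is finite; (b) −S ⊆ ℭ_Λ, i.e. for every α ∈ S and every λ ∈ Λ one has λ − α ∈ Λ; (c) (𝒜 + S) ∩ Λ ⊆ 𝒜, i.e. for every λ ∈ 𝒜 and α ∈ S, if λ + α ∈ Λ then λ + α ∈ 𝒜. Then there exists μ ∈ 𝒜 such that for every function m : S → ℕ, if μ + Σ_{α ∈ S} m(α)·α ∈ Λ then Σ_{α ∈ S} m(α)·α = 0; in other words (μ + span_{ℤ≥0} S) ∩ Λ = {μ}. -/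
section

variable {G : Type*} [AddCommGroup G] {Λ 𝒜 : Set G} {S : Finset G}

/-- If subtracting each `α ∈ S` preserves `Λ`, so does subtracting any `ℕ`-combination of `S`. -/
theorem sub_sum_nsmul_mem (hb : ∀ α ∈ S, ∀ lam ∈ Λ, lam - α ∈ Λ) {T : Finset G} (hT : T ⊆ S)
    (m : G → ℕ) {x : G} (hx : x ∈ Λ) : x - ∑ α ∈ T, m α • α ∈ Λ := by
  let C : AddSubmonoid G :=
    { carrier := {β | ∀ x ∈ Λ, x - β ∈ Λ}
      zero_mem' := fun x hx => by simpa using hx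
      add_mem' := fun {β γ} hβ hγ x hx => by
        rw [← sub_sub]
        exact hγ _ (hβ _ hx) }
  have h : ∑ α ∈ T, m α • α ∈ C :=
    C.sum_mem fun α hα => C.nsmul_mem (show α ∈ C from hb α (hT hα)) _
  exact h x hx

/-- If `Λ` is stable under subtracting elements of `S` and `(𝒜 + S) ∩ Λ ⊆ 𝒜`, then the latter
inclusion also holds for `ℕ`-combinations of `S`. -/
theorem add_sum_nsmul_mem (hb : ∀ α ∈ S, ∀ lam ∈ Λ, lam - α ∈ Λ)
    (hc : ∀ lam ∈ 𝒜, ∀ α ∈ S, lam + α ∈ Λ → lam + α ∈ 𝒜) (m : G → ℕ) {x : G} (hx : x ∈ 𝒜)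
    (hxm : x + ∑ α ∈ S, m α • α ∈ Λ) : x + ∑ α ∈ S, m α • α ∈ 𝒜 := by
  let C : AddSubmonoid G :=
    { carrier := {β | (∀ x ∈ Λ, x - β ∈ Λ) ∧ ∀ x ∈ 𝒜, x + β ∈ Λ → x + β ∈ 𝒜}
      zero_mem' := ⟨fun x hx => by simpa using hx, fun x hx _ => by simpa using hx⟩
      add_mem' := fun {β γ} hβ hγ => by
        refine ⟨fun x hx => ?_, fun x hx h => ?_⟩
        · rw [← sub_sub]
          exact hγ.1 _ (hβ.1 _ hx)
        · rw [← add_assoc] at h ⊢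
          have h' : x + β ∈ Λ := by simpa using hγ.1 _ h
          exact hγ.2 _ (hβ.2 x hx h') h }
  have h : ∑ α ∈ S, m α • α ∈ C :=
    C.sum_mem fun α hα =>
      C.nsmul_mem (show α ∈ C from ⟨hb α hα, fun x hx => hc x hx α hα⟩) _
  exact h.2 x hx hxm

/-- The total multiplicities of the `ℕ`-combinations of `S` that keep `x` inside `Λ` are bounded. -/
theorem bddAbove_sum_of_add_sum_nsmul_mem
    (ha : ∀ α ∈ S, ∀ lam ∈ Λ, {j : ℤ | 0 < j ∧ lam + j • α ∈ Λ}.Finite)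
    (hb : ∀ α ∈ S, ∀ lam ∈ Λ, lam - α ∈ Λ) {x : G} (hx : x ∈ Λ) :
    BddAbove {n : ℕ | ∃ m : G → ℕ, x + ∑ α ∈ S, m α • α ∈ Λ ∧ ∑ α ∈ S, m α = n} := by
  classical
  have hN : ∀ α, ∃ N : ℕ, α ∈ S → ∀ k : ℕ, x + k • α ∈ Λ → k ≤ N := by
    intro α
    by_cases hα : α ∈ S
    · obtain ⟨b, hbd⟩ := (ha α hα x hx).bddAbove
      refine ⟨b.toNat, fun _ k hk => ?_⟩
      rcases Nat.eq_zero_or_pos k with rfl | hpos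
      · exact Nat.zero_le _
      · have : (k : ℤ) ≤ b := hbd ⟨by exact_mod_cast hpos, by simpa using hk⟩
        omega
    · exact ⟨0, fun h => absurd h hα⟩
  choose N hN using hN
  refine ⟨∑ α ∈ S, N α, ?_⟩
  rintro _ ⟨m, hm, rfl⟩
  refine Finset.sum_le_sum fun α hα => hN α hα _ ?_
  have h := sub_sum_nsmul_mem hb (Finset.erase_subset α S) m hm
  rwa [← Finset.add_sum_erase S (fun α => m α • α) hα, ← add_assoc, add_sub_cancel_right] at h

end


/-- Proposition 4.5(i) of the paper (combinatorial form): if `S ⊆ 𝔅_Λ`, `-S ⊆ ℭ_Λ` and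
`(𝒜 + S) ∩ Λ ⊆ 𝒜`, then there is `μ ∈ 𝒜` with `(μ + span_{ℤ≥0} S) ∩ Λ = {μ}`. -/
theorem stmt_1 (G : Type*) [AddCommGroup G]
    (Λ 𝒜 : Set G) (h𝒜Λ : 𝒜 ⊆ Λ) (h𝒜 : 𝒜.Nonempty)
    (S : Finset G) (hS : S.Nonempty)
    (ha : ∀ α ∈ S, ∀ lam ∈ Λ, {j : ℤ | 0 < j ∧ lam + j • α ∈ Λ}.Finite)
    (hb : ∀ α ∈ S, ∀ lam ∈ Λ, lam - α ∈ Λ)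
    (hc : ∀ lam ∈ 𝒜, ∀ α ∈ S, lam + α ∈ Λ → lam + α ∈ 𝒜) :
    ∃ μ ∈ 𝒜, ∀ m : G → ℕ,
      μ + ∑ α ∈ S, m α • α ∈ Λ → ∑ α ∈ S, m α • α = 0 := by
  obtain ⟨x, hx⟩ := h𝒜
  let D : Set ℕ := {n : ℕ | ∃ m : G → ℕ, x + ∑ α ∈ S, m α • α ∈ Λ ∧ ∑ α ∈ S, m α = n}
  have hD : BddAbove D := bddAbove_sum_of_add_sum_nsmul_mem ha hb (h𝒜Λ hx)
  have hne : D.Nonempty := ⟨0, fun _ => 0, by simpa using h𝒜Λ hx, by simp⟩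
  obtain ⟨m, hm, hsum⟩ := Nat.sSup_mem hne hD
  refine ⟨x + ∑ α ∈ S, m α • α, add_sum_nsmul_mem hb hc m hx hm, fun m' hm' => ?_⟩
  have hle : ∑ α ∈ S, (m α + m' α) ≤ sSup D :=
    le_csSup hD ⟨fun α => m α + m' α, by
      simpa only [add_nsmul, Finset.sum_add_distrib, add_assoc] using hm', rfl⟩
  rw [Finset.sum_add_distrib, hsum] at hle
  have hzero : ∑ α ∈ S, m' α = 0 := Nat.eq_zero_of_le_zero (by omega)
  refine Finset.sum_eq_zero fun α hα => ?_
  rw [Finset.sum_eq_zero_iff.1 hzero α hα, zero_nsmul]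
end

section
/- Let V be a real vector space, let Λ ⊆ V be nonempty, let Φ ⊆ V be a finite subset, let δ ∈ V, and let p be a positive integer such that p·δ ≠ 0 and p·δ ∈ span_{ℤ≥0} Φ (i.e. p·δ is a sum Σ_{α ∈ Φ} m(α)·α with nonnegative integer coefficients m(α)). If Φ ⊆ 𝔅_Λ and −Φ ⊆ ℭ_Λ, then there exists λ ∈ Λ such that λ + n·p·δ ∉ Λ for every n ∈ ℤ_{>0}. -/
/-- The translations `-γ` preserving a set `Λ` form a submonoid. -/
def subStabilizer {V : Type*} [AddCommGroup V] (Λ : Set V) : AddSubmonoid V where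
  carrier := {γ | ∀ x ∈ Λ, x - γ ∈ Λ}
  zero_mem' := by simp
  add_mem' := by
    intro a b ha hb x hx
    rw [← sub_sub]
    exact hb _ (ha x hx)

theorem exists_le_add_nsmul_mem {V : Type*} [AddCommGroup V] {Λ : Set V} {β : V}
    (h : ∀ x ∈ Λ, ∃ n : ℕ, 0 < n ∧ x + n • β ∈ Λ) {x : V} (hx : x ∈ Λ) (N : ℕ) :
    ∃ n : ℕ, N ≤ n ∧ x + n • β ∈ Λ := by
  induction N with
  | zero => exact ⟨0, le_rfl, by simpa using hx⟩
  | succ N ih =>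
    obtain ⟨n, hn, hmem⟩ := ih
    obtain ⟨k, hk, hmem'⟩ := h _ hmem
    exact ⟨n + k, by omega, by rwa [add_nsmul, ← add_assoc]⟩

/-- The mechanism behind Proposition 4.5(ii)(a) of the paper: if `Φ ⊆ 𝔅_Λ`, `-Φ ⊆ ℭ_Λ` and
a positive multiple `p·δ ≠ 0` of `δ` lies in the `ℤ≥0`-span of the finite set `Φ`, then
there is `λ ∈ Λ` with `λ + n·p·δ ∉ Λ` for all positive integers `n`. -/
theorem stmt_2 (V : Type*) [AddCommGroup V] [Module ℝ V]
    (Λ : Set V) (hΛ : Λ.Nonempty)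
    (Φ : Finset V) (δ : V) (p : ℕ) (hp : 0 < p)
    (hpδ : p • δ ≠ 0)
    (hspan : ∃ m : V → ℕ, p • δ = ∑ α ∈ Φ, m α • α)
    (hB : ∀ α ∈ Φ, ∀ lam ∈ Λ, {j : ℤ | 0 < j ∧ lam + j • α ∈ Λ}.Finite)
    (hC : ∀ α ∈ Φ, ∀ lam ∈ Λ, lam - α ∈ Λ) :
    ∃ lam ∈ Λ, ∀ n : ℕ, 0 < n → lam + (n * p) • δ ∉ Λ := by
  obtain ⟨m, hm⟩ := hspan
  by_contra! hcon
  obtain ⟨α, hα, hmα⟩ : ∃ α ∈ Φ, m α • α ≠ 0 :=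
    Finset.exists_ne_zero_of_sum_ne_zero (hm ▸ hpδ)
  have hmpos : 0 < m α := Nat.pos_of_ne_zero fun h0 => hmα (by rw [h0, zero_nsmul])
  obtain ⟨x, hx⟩ := hΛ
  have hunb := exists_le_add_nsmul_mem (β := p • δ)
    (fun y hy => by
      obtain ⟨n, hn, hmem⟩ := hcon y hy
      exact ⟨n, hn, by rwa [← mul_nsmul']⟩) hx
  obtain ⟨B, hBd⟩ := (hB α hα x hx).bddAbove
  obtain ⟨n, hn, hmem⟩ := hunb (B.toNat + 1)
  classical
  have hrest : n • ∑ γ ∈ Φ.erase α, m γ • γ ∈ subStabilizer Λ :=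
    nsmul_mem (sum_mem fun γ hγ =>
      nsmul_mem (show γ ∈ subStabilizer Λ from hC γ (Finset.mem_of_mem_erase hγ)) _) _
  have hline : x + ((n * m α : ℕ) : ℤ) • α ∈ Λ := by
    convert hrest _ hmem using 1
    rw [hm, ← Finset.add_sum_erase Φ _ hα, nsmul_add, natCast_zsmul, mul_nsmul']
    abel
  have hle : n ≤ n * m α := Nat.le_mul_of_pos_right n hmpos
  have := hBd ⟨by omega, hline⟩
  omega
end

section
/- Let V₀ be a real vector space, set V := V₀ × ℝ, write δ := (0, 1) and identify V₀ with V₀ × {0}. Let f : V → ℝ be linear with f(δ) > 0. Let D ⊆ V₀ ∖ {0} be a finite set with D = −D, and for each α̇ ∈ D let r_{α̇} ∈ ℤ_{>0} and k_{α̇} ∈ ℤ be given; set S_{α̇} := {k_{α̇} + r_{α̇}·n | n ∈ ℤ} ⊆ ℤ, and assume that for all α̇ ∈ D and n ∈ ℤ one has n ∈ S_{α̇} if and only if −n ∈ S_{−α̇}. Set T := {α̇ + s·δ | α̇ ∈ D, s ∈ S_{α̇}}. Let Λ ⊆ V be nonempty and assume: (1) every β ∈ T with f(β) > 0 lies in 𝔅_Λ;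 (2) every β ∈ T with f(β) < 0 lies in ℭ_Λ; (3) there exist λ₀ ∈ Λ and p ∈ ℤ_{>0} such that λ₀ + n·p·δ ∉ Λ for all n ∈ ℤ_{>0}; (4) there exists α̇* ∈ D with S_{α̇*} = ℤ. Then there exists μ ∈ Λ such that μ + β ∉ Λ for every β ∈ T ∪ {m·δ | m ∈ ℤ_{>0}} with f(β) > 0. -/
/-- If `Λ` is stable under subtracting each of finitely many vectors and no ray in the direction of
one of these vectors stays in `Λ`, then every point of `Λ` can be moved to a point of `Λ` that is
maximal for all these vectors, without creating new translates inside `Λ`. -/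
theorem exists_mem_forall_add_notMem {V : Type*} [AddCommGroup V] (Λ : Set V) (B : Finset V)
    (hsub : ∀ β ∈ B, ∀ x ∈ Λ, x - β ∈ Λ)
    (hfin : ∀ β ∈ B, ∀ x ∈ Λ, ∃ n : ℕ, x + n • β ∉ Λ) {x₀ : V} (hx₀ : x₀ ∈ Λ) :
    ∃ x ∈ Λ, (∀ β ∈ B, x + β ∉ Λ) ∧ ∀ v, x₀ + v ∉ Λ → x + v ∉ Λ := by
  classical
  induction B using Finset.induction_on with
  | empty => exact ⟨x₀, hx₀, by simp, fun _ h => h⟩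
  | insert b B _ ih =>
    obtain ⟨y, hy, hyB, hyv⟩ := ih
      (fun β hβ => hsub β (Finset.mem_insert_of_mem hβ))
      (fun β hβ => hfin β (Finset.mem_insert_of_mem hβ))
    have hb := Finset.mem_insert_self b B
    have hdown : ∀ (n : ℕ) (v : V), y + v ∉ Λ → y + n • b + v ∉ Λ := by
      intro n v hv
      induction n with
      | zero => simpa using hv
      | succ n ihn =>
        intro h
        apply ihn
        have := hsub b hb _ h
        rwa [show y + (n + 1) • b + v - b = y + n • b + v by rw [succ_nsmul]; abel] at this
    have hex := hfin b hb y hy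
    have hpos : Nat.find hex ≠ 0 := by
      intro h0
      have := Nat.find_spec hex
      rw [h0] at this
      simp [hy] at this
    obtain ⟨n, hn⟩ := Nat.exists_eq_succ_of_ne_zero hpos
    have hmem : y + n • b ∈ Λ := by
      have := Nat.find_min hex (m := n) (by omega)
      simpa using this
    have hnot : y + n • b + b ∉ Λ := by
      have := Nat.find_spec hex
      rwa [hn, Nat.succ_eq_add_one, succ_nsmul, ← add_assoc] at this
    refine ⟨y + n • b, hmem, ?_, fun v hv => hdown n v (hyv v hv)⟩
    intro β hβ
    rcases Finset.mem_insert.mp hβ with rfl | hβ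
    · exact hnot
    · exact hdown n β (hyB β hβ)

/-- An arithmetic progression of integers with positive difference has a least element `s` with
`0 < c + s * d`, for `d` positive. -/
theorem exists_least_int_progression (c d : ℝ) (hd : 0 < d) (k r : ℤ) (hr : 0 < r) :
    ∃ s : ℤ, (∃ n : ℤ, s = k + r * n) ∧ 0 < c + s * d ∧
      ∀ t : ℤ, (∃ n : ℤ, t = k + r * n) → 0 < c + t * d → s ≤ t := by
  have hiff : ∀ t : ℤ, 0 < c + t * d ↔ -c / d < t := by
    intro t
    rw [div_lt_iff₀ hd]
    constructor <;> intro h <;> linarith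
  obtain ⟨s, ⟨hs, hs'⟩, hmin⟩ := Int.exists_least_of_bdd
    (P := fun s : ℤ => (∃ n : ℤ, s = k + r * n) ∧ 0 < c + s * d)
    ⟨⌊-c / d⌋, fun z hz => by
      have h1 := (hiff z).mp hz.2
      have h2 := Int.floor_le (-c / d)
      exact_mod_cast (h2.trans h1.le)⟩
    (by
      refine ⟨k + r * (|⌈-c / d⌉ - k| + 1), ⟨_, rfl⟩, ?_⟩
      rw [hiff]
      refine (Int.le_ceil (-c / d)).trans_lt ?_
      have h1 := le_abs_self (⌈-c / d⌉ - k)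
      have h2 := abs_nonneg (⌈-c / d⌉ - k)
      exact_mod_cast (by nlinarith : ⌈-c / d⌉ < k + r * (|⌈-c / d⌉ - k| + 1)))
  exact ⟨s, hs, hs', fun t ht ht' => hmin t ⟨ht, ht'⟩⟩


/-- The combinatorial content of Proposition 4.5(ii)(b) of the paper: under the hypotheses on
the set of real roots `T` (with arithmetic progressions `S_{α̇}` of `δ`-shifts), the support
`Λ`, the functional `f` with `f(δ) > 0`, the existence of a weight `λ₀` with no `p·δ`-string
upwards, and of a dot root with `S_{α̇} = ℤ`, there is `μ ∈ Λ` with `μ + β ∉ Λ` for every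
positive root `β ∈ T ∪ ℤ_{>0}δ`. -/
theorem stmt_3 (V₀ : Type*) [AddCommGroup V₀] [Module ℝ V₀]
    (f : (V₀ × ℝ) →ₗ[ℝ] ℝ)
    (δ : V₀ × ℝ) (hδdef : δ = (0, 1))
    (hfδ : 0 < f δ)
    (D : Finset V₀) (hD0 : (0 : V₀) ∉ D) (hDsym : ∀ a ∈ D, -a ∈ D)
    (r : V₀ → ℤ) (k : V₀ → ℤ) (hr : ∀ a ∈ D, 0 < r a)
    (S : V₀ → Set ℤ) (hSdef : ∀ a, S a = {s : ℤ | ∃ n : ℤ, s = k a + r a * n})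
    (hsym : ∀ a ∈ D, ∀ n : ℤ, n ∈ S a ↔ -n ∈ S (-a))
    (T : Set (V₀ × ℝ))
    (hT : T = {β : V₀ × ℝ | ∃ a ∈ D, ∃ s ∈ S a, β = (a, (s : ℝ))})
    (Λ : Set (V₀ × ℝ)) (hΛ : Λ.Nonempty)
    (h1 : ∀ β ∈ T, 0 < f β →
      ∀ lam ∈ Λ, {m : ℤ | 0 < m ∧ lam + m • β ∈ Λ}.Finite)
    (h2 : ∀ β ∈ T, f β < 0 → ∀ lam ∈ Λ, β + lam ∈ Λ)
    (h3 : ∃ lam₀ ∈ Λ, ∃ p : ℤ, 0 < p ∧ ∀ n : ℤ, 0 < n → lam₀ + (n * p) • δ ∉ Λ)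
    (h4 : ∃ a ∈ D, S a = Set.univ) :
    ∃ μ ∈ Λ, ∀ β ∈ T ∪ {γ : V₀ × ℝ | ∃ m : ℤ, 0 < m ∧ γ = m • δ},
      0 < f β → μ + β ∉ Λ := by
  classical
  have hmk : ∀ (a : V₀) (t : ℝ), f (a, t) = f (a, 0) + t * f δ := by
    intro a t
    have : ((a, t) : V₀ × ℝ) = (a, 0) + t • δ := by simp [hδdef]
    rw [this, map_add, map_smul, smul_eq_mul]
  have hzδ : ∀ m : ℤ, m • δ = ((0 : V₀), (m : ℝ)) := by
    intro m
    simp [hδdef]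
  have hfin : ∀ β ∈ T, 0 < f β → ∀ x ∈ Λ, ∃ n : ℕ, x + n • β ∉ Λ := by
    intro β hβ hfβ x hx
    by_contra! hall
    have hinj : Function.Injective fun n : ℕ => (n : ℤ) + 1 := fun m n h => by simpa using h
    refine Set.infinite_of_injective_forall_mem hinj (fun n => ?_) (h1 β hβ hfβ x hx)
    refine ⟨by positivity, ?_⟩
    have := hall (n + 1)
    rwa [← natCast_zsmul, Nat.cast_succ] at this
  have hneg : ∀ β ∈ T, -β ∈ T := by
    intro β hβ
    rw [hT] at hβ ⊢
    obtain ⟨a, ha, s, hs, rfl⟩ := hβ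
    exact ⟨-a, hDsym a ha, -s, (hsym a ha s).mp hs, by simp⟩
  have hsub : ∀ β ∈ T, 0 < f β → ∀ x ∈ Λ, x - β ∈ Λ := by
    intro β hβ hfβ x hx
    have := h2 (-β) (hneg β hβ) (by simpa using hfβ) x hx
    rwa [neg_add_eq_sub] at this
  have hδsub : ∀ j : ℤ, 2 ≤ j → ∀ x ∈ Λ, x - j • δ ∈ Λ := by
    intro j hj x hx
    obtain ⟨a, ha, haS⟩ := h4
    set c := f (a, 0) / f δ with hc
    have hfa : f (a, 0) = c * f δ := by rw [hc]; field_simp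
    set s : ℤ := ⌊-c⌋ + 1 with hs
    have hs1 : -c < s := by rw [hs]; push_cast; exact Int.lt_floor_add_one _
    have hs2 : (s : ℝ) ≤ -c + 1 := by
      rw [hs]; push_cast; linarith [Int.floor_le (-c)]
    have hj' : (2 : ℝ) ≤ j := by exact_mod_cast hj
    have hT1 : ((a, (s : ℝ)) : V₀ × ℝ) ∈ T := by
      rw [hT]; exact ⟨a, ha, s, by simp [haS], rfl⟩
    have hT2 : ((a, ((s - j : ℤ) : ℝ)) : V₀ × ℝ) ∈ T := by
      rw [hT]; exact ⟨a, ha, s - j, by simp [haS], rfl⟩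
    have hx1 := hsub _ hT1 (by rw [hmk, hfa, ← add_mul]; exact mul_pos (by linarith) hfδ) x hx
    have hx2 := h2 _ hT2 (by
      rw [hmk, hfa, ← add_mul]
      exact mul_neg_of_neg_of_pos (by push_cast; linarith) hfδ) _ hx1
    have hsum : ((a, ((s - j : ℤ) : ℝ)) : V₀ × ℝ) + (x - (a, (s : ℝ))) = x - j • δ := by
      rw [hzδ]
      ext <;> simp
    rwa [hsum] at hx2
  obtain ⟨x₀, hx₀, hx₀δ⟩ : ∃ x ∈ Λ, ∀ m : ℤ, 0 < m → x + m • δ ∉ Λ := by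
    obtain ⟨y, hy, p, hp, hyp⟩ := h3
    obtain ⟨m, hm, hmax⟩ := Int.exists_greatest_of_bdd (P := fun m : ℤ => y + m • δ ∈ Λ)
      ⟨p + 1, fun z hz => by
        by_contra! hlt
        apply hyp 1 one_pos
        rw [one_mul]
        have := hδsub (z - p) (by omega) _ hz
        rwa [sub_smul, show y + z • δ - (z • δ - p • δ) = y + p • δ by abel] at this⟩
      ⟨0, by simpa using hy⟩
    refine ⟨y + m • δ, hm, fun n hn h => ?_⟩
    have := hmax (m + n) (by rwa [add_smul, ← add_assoc])
    omega
  choose! s hsS hspos hsmin using fun (a : V₀) (ha : a ∈ D) =>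
    exists_least_int_progression (f (a, 0)) (f δ) hfδ (k a) (r a) (hr a ha)
  have hβT : ∀ a ∈ D, ((a, (s a : ℝ)) : V₀ × ℝ) ∈ T := by
    intro a ha
    rw [hT]
    exact ⟨a, ha, s a, by rw [hSdef]; exact hsS a ha, rfl⟩
  have hβpos : ∀ a ∈ D, 0 < f (a, (s a : ℝ)) := by
    intro a ha
    rw [hmk]
    exact hspos a ha
  obtain ⟨μ, hμ, hμB, hμv⟩ := exists_mem_forall_add_notMem Λ
    (D.image fun a => ((a, (s a : ℝ)) : V₀ × ℝ))
    (Finset.forall_mem_image.mpr fun a ha => hsub _ (hβT a ha) (hβpos a ha))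
    (Finset.forall_mem_image.mpr fun a ha => hfin _ (hβT a ha) (hβpos a ha)) hx₀
  refine ⟨μ, hμ, ?_⟩
  rintro β (hβ | ⟨m, hm, rfl⟩) hfβ hmem
  · rw [hT] at hβ
    obtain ⟨a, ha, t, ht, rfl⟩ := hβ
    rw [hmk] at hfβ
    rw [hSdef] at ht
    rcases (hsmin a ha t ht hfβ).eq_or_lt with heq | hlt
    · exact hμB _ (Finset.mem_image_of_mem _ ha) (by rwa [heq])
    · refine hμv _ (hx₀δ (t - s a) (by omega)) ?_
      have := hsub _ (hβT a ha) (hβpos a ha) _ hmem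
      have hdiff : μ + ((a, (t : ℝ)) : V₀ × ℝ) - (a, (s a : ℝ)) = μ + (t - s a) • δ := by
        rw [hzδ]
        ext <;> simp
        ring
      rwa [hdiff] at this
  · exact hμv _ (hx₀δ m hm) hmem
end

section
/- Let M be a complex vector space and let h, e, f be linear endomorphisms of M satisfying h∘e − e∘h = 2e, h∘f − f∘h = −2f and e∘f − f∘e = h. Assume M equals the sum of the eigenspaces of h, that every eigenspace of h is finite-dimensional, and that e and f are locally nilpotent. If n is an integer which is an eigenvalue of h on M (i.e. ker(h − n·id) ≠ 0) and n > 0, then n − 2 is an eigenvalue of h on M; and if n < 0, then n + 2 is an eigenvalue of h on M. -/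
section Sl2

variable {M : Type*} [AddCommGroup M] [Module ℂ M] {h e f : Module.End ℂ M} {μ : ℂ} {v : M}

/-- In an `sl₂`-representation, `e` raises `h`-weights by `2`. -/
lemma sl2_h_pow_e_apply (he : h * e - e * h = (2 : ℂ) • e) (hv : h v = μ • v) (k : ℕ) :
    h ((e ^ k) v) = (μ + 2 * k) • (e ^ k) v := by
  induction k with
  | zero => simpa using hv
  | succ k ih =>
    have := LinearMap.congr_fun he ((e ^ k) v)
    simp only [LinearMap.sub_apply, Module.End.mul_apply, LinearMap.smul_apply, ih, map_smul] at this
    rw [pow_succ', Module.End.mul_apply, sub_eq_iff_eq_add.mp this]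
    push_cast
    module

/-- The action of `f` on the string generated under `e` by a lowest weight vector. -/
lemma sl2_f_pow_e_apply (he : h * e - e * h = (2 : ℂ) • e) (hef : e * f - f * e = h)
    (hv : h v = μ • v) (hfv : f v = 0) (k : ℕ) :
    f ((e ^ (k + 1)) v) = (-((k + 1) * (μ + k))) • (e ^ k) v := by
  have key (j : ℕ) : f ((e ^ (j + 1)) v) = e (f ((e ^ j) v)) - (μ + 2 * j) • (e ^ j) v := by
    rw [← sl2_h_pow_e_apply he hv, ← hef, pow_succ']
    simp
  induction k with
  | zero => simpa [hfv] using key 0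
  | succ k ih =>
    rw [key, ih, map_smul, ← Module.End.mul_apply e, ← pow_succ']
    push_cast
    module

/-- A vector of positive integral weight on which `e` acts nilpotently is not killed by `f`. -/
lemma sl2_f_apply_ne_zero (he : h * e - e * h = (2 : ℂ) • e) (hef : e * f - f * e = h)
    (hle : ∃ k : ℕ, (e ^ k) v = 0) {n : ℤ} (hn : 0 < n) (hv : h v = (n : ℂ) • v) (hv0 : v ≠ 0) :
    f v ≠ 0 := by
  intro hfv
  have hne (k : ℕ) : (e ^ k) v ≠ 0 := by
    induction k with
    | zero => simpa using hv0
    | succ k ih =>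
      intro h0
      have hf := sl2_f_pow_e_apply he hef hv hfv k
      rw [h0, map_zero, eq_comm, smul_eq_zero_iff_left ih, neg_eq_zero] at hf
      have : ((k : ℤ) + 1) * (n + k) = 0 := by exact_mod_cast hf
      exact absurd this (by positivity)
  obtain ⟨k, hk⟩ := hle
  exact hne k hk

/-- If `n > 0` is a weight of an `sl₂`-representation with `e` locally nilpotent, so is `n - 2`. -/
lemma sl2_eigenspace_sub_two_ne_bot (he : h * e - e * h = (2 : ℂ) • e)
    (hf : h * f - f * h = -((2 : ℂ) • f)) (hef : e * f - f * e = h)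
    (hle : ∀ v : M, ∃ k : ℕ, (e ^ k) v = 0) {n : ℤ} (hn : 0 < n)
    (hne : h.eigenspace (n : ℂ) ≠ ⊥) : h.eigenspace ((n : ℂ) - 2) ≠ ⊥ := by
  obtain ⟨v, hv, hv0⟩ := Submodule.exists_mem_ne_zero_of_ne_bot hne
  rw [Module.End.mem_eigenspace_iff] at hv
  refine (Submodule.ne_bot_iff _).mpr
    ⟨f v, Module.End.mem_eigenspace_iff.mpr ?_, sl2_f_apply_ne_zero he hef (hle v) hn hv hv0⟩
  have := LinearMap.congr_fun hf v
  simp only [LinearMap.sub_apply, Module.End.mul_apply, LinearMap.neg_apply,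
    LinearMap.smul_apply, hv, map_smul] at this
  rw [sub_eq_iff_eq_add.mp this]
  module

lemma eigenspace_neg_eq (h : Module.End ℂ M) (μ : ℂ) :
    (-h).eigenspace μ = h.eigenspace (-μ) := by
  ext v
  simp [neg_eq_iff_eq_neg]

end Sl2

/-- The string property of Proposition 4.4(ii) of the paper, in sl₂-form: for an sl₂-triple
`(h, e, f)` acting on a finite weight complex vector space `M` with `e`, `f` locally nilpotent,
if an integer `n` is an eigenvalue of `h` and `n > 0` then `n - 2` is an eigenvalue, and if
`n < 0` then `n + 2` is an eigenvalue. -/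
theorem stmt_5 (M : Type*) [AddCommGroup M] [Module ℂ M]
    (h e f : Module.End ℂ M)
    (he : h * e - e * h = (2 : ℂ) • e)
    (hf : h * f - f * h = -((2 : ℂ) • f))
    (hef : e * f - f * e = h)
    (hsum : ⨆ μ : ℂ, h.eigenspace μ = ⊤)
    (hfin : ∀ μ : ℂ, FiniteDimensional ℂ (h.eigenspace μ))
    (hle : ∀ v : M, ∃ n : ℕ, (e ^ n) v = 0)
    (hlf : ∀ v : M, ∃ n : ℕ, (f ^ n) v = 0) :
    ∀ n : ℤ, h.eigenspace (n : ℂ) ≠ ⊥ →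
      (0 < n → h.eigenspace ((n : ℂ) - 2) ≠ ⊥) ∧
      (n < 0 → h.eigenspace ((n : ℂ) + 2) ≠ ⊥) := by
  intro n hne
  refine ⟨fun hn => sl2_eigenspace_sub_two_ne_bot he hf hef hle hn hne, fun hn => ?_⟩
  have := sl2_eigenspace_sub_two_ne_bot (h := -h) (e := f) (f := e) (n := -n)
    (by rw [neg_mul, mul_neg, sub_neg_eq_add, neg_add_eq_sub, ← neg_sub, hf, neg_neg])
    (by rw [neg_mul, mul_neg, sub_neg_eq_add, neg_add_eq_sub, ← neg_sub, he])
    (by rw [← hef, neg_sub]) hlf (by lia) (by simpa [eigenspace_neg_eq] using hne)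
  rw [eigenspace_neg_eq] at this
  convert this using 2
  push_cast
  ring
end

section
/- Let M be a complex vector space and let h, e, f be linear endomorphisms of M satisfying h∘e − e∘h = 2e, h∘f − f∘h = −2f and e∘f − f∘e = h. Assume M equals the sum of the eigenspaces of h, that every eigenspace of h is finite-dimensional, and that e and f are locally nilpotent. If μ and μ + 2 are both eigenvalues of h on M, then e does not vanish on the μ-eigenspace of h, i.e. e(ker(h − μ·id)) ≠ {0}. -/
/-- If `v` has `h`-weight `ν`, then `(f ^ k) v` has `h`-weight `ν - 2 * k`. -/
lemma h_apply_pow_f {M : Type*} [AddCommGroup M] [Module ℂ M] {h f : Module.End ℂ M}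
    (hf : h * f - f * h = -((2 : ℂ) • f)) {v : M} {ν : ℂ} (hv : h v = ν • v) (k : ℕ) :
    h ((f ^ k) v) = (ν - 2 * k) • (f ^ k) v := by
  induction k with
  | zero => simpa using hv
  | succ k ih =>
    have key := LinearMap.congr_fun hf ((f ^ k) v)
    simp only [LinearMap.sub_apply, Module.End.mul_apply, LinearMap.neg_apply,
      LinearMap.smul_apply, ih, map_smul] at key
    rw [pow_succ', Module.End.mul_apply, eq_add_of_sub_eq key]
    push_cast
    module

/-- The usual `sl₂`-string formula, for a weight vector `v` that is only assumed to satisfy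
`f (e v) = 0` instead of `e v = 0`. -/
lemma e_apply_pow_succ_f {M : Type*} [AddCommGroup M] [Module ℂ M] {h e f : Module.End ℂ M}
    (hf : h * f - f * h = -((2 : ℂ) • f)) (hef : e * f - f * e = h)
    {v : M} {ν : ℂ} (hv : h v = ν • v) (hfe : f (e v) = 0) (k : ℕ) :
    e ((f ^ (k + 1)) v) = ((k + 1) * (ν - k)) • (f ^ k) v := by
  have comm (x : M) : e (f x) = h x + f (e x) := by
    rw [← hef]
    simp
  induction k with
  | zero => simp [comm, hv, hfe]
  | succ k ih =>
    rw [pow_succ', Module.End.mul_apply, comm, ih, h_apply_pow_f hf hv, map_smul,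
      ← Module.End.mul_apply, ← pow_succ']
    push_cast
    module

/-- The weight of a nonzero vector `v` with `f (e v) = 0` that is killed by a power of `f` is a
natural number. -/
lemma exists_nat_eq_weight {M : Type*} [AddCommGroup M] [Module ℂ M] {h e f : Module.End ℂ M}
    (hf : h * f - f * h = -((2 : ℂ) • f)) (hef : e * f - f * e = h)
    {v : M} {ν : ℂ} (hv : h v = ν • v) (hfe : f (e v) = 0) (hv0 : v ≠ 0)
    (hnil : ∃ n : ℕ, (f ^ n) v = 0) : ∃ n : ℕ, ν = n := by
  obtain ⟨n, hn, hn'⟩ := Nat.exists_not_and_succ_of_not_zero_of_exists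
    (p := fun n ↦ (f ^ n) v = 0) (by simpa using hv0) hnil
  refine ⟨n, ?_⟩
  have key := e_apply_pow_succ_f hf hef hv hfe n
  rw [hn', map_zero, eq_comm, smul_eq_zero_iff_left hn, mul_eq_zero, sub_eq_zero] at key
  exact key.resolve_left n.cast_add_one_ne_zero

/-- Proposition 4.4(i) of the paper, in sl₂-form: for an sl₂-triple `(h, e, f)` acting on a
finite weight complex vector space `M` with `e`, `f` locally nilpotent, if `μ` and `μ + 2` are
both eigenvalues of `h`, then `e` does not vanish on the `μ`-eigenspace of `h`. -/
theorem stmt_6 (M : Type*) [AddCommGroup M] [Module ℂ M]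
    (h e f : Module.End ℂ M)
    (he : h * e - e * h = (2 : ℂ) • e)
    (hf : h * f - f * h = -((2 : ℂ) • f))
    (hef : e * f - f * e = h)
    (hsum : ⨆ μ : ℂ, h.eigenspace μ = ⊤)
    (hfin : ∀ μ : ℂ, FiniteDimensional ℂ (h.eigenspace μ))
    (hle : ∀ v : M, ∃ n : ℕ, (e ^ n) v = 0)
    (hlf : ∀ v : M, ∃ n : ℕ, (f ^ n) v = 0) :
    ∀ μ : ℂ, h.eigenspace μ ≠ ⊥ → h.eigenspace (μ + 2) ≠ ⊥ →
      Submodule.map e (h.eigenspace μ) ≠ ⊥ := by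
  intro μ hμ hμ2 hmap
  obtain ⟨v, hv, hv0⟩ := Submodule.exists_mem_ne_zero_of_ne_bot hμ
  obtain ⟨w, hw, hw0⟩ := Submodule.exists_mem_ne_zero_of_ne_bot hμ2
  rw [Module.End.mem_eigenspace_iff] at hv hw
  have e_zero (x : M) (hx : h x = μ • x) : e x = 0 :=
    (Submodule.eq_bot_iff _).mp hmap _
      (Submodule.mem_map_of_mem (Module.End.mem_eigenspace_iff.mpr hx))
  obtain ⟨n, hn⟩ := exists_nat_eq_weight hf hef hv (by rw [e_zero v hv, map_zero]) hv0 (hlf v)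
  have hfw : h (f w) = μ • f w := by
    have := h_apply_pow_f hf hw 1
    simpa using this
  obtain ⟨m, hm⟩ := exists_nat_eq_weight (h := -h) (e := f) (f := e) (ν := -(μ + 2))
    (by rw [← he]; noncomm_ring) (by rw [← hef]; noncomm_ring)
    (by rw [LinearMap.neg_apply, hw, neg_smul]) (e_zero _ hfw) hw0 (hle w)
  have : ((n + m + 2 : ℕ) : ℂ) = 0 := by
    push_cast
    rw [← hn, ← hm]
    ring
  exact absurd (Nat.cast_eq_zero.mp this) (by lia)
end

section
/- Let V be a real vector space equipped with a symmetric bilinear form B. Let δ, α̇ ∈ V with B(δ, δ) = 0, B(α̇, δ) = 0 and B(α̇, α̇) ≠ 0. Fix r ∈ ℤ_{>0} and k ∈ ℤ, and set A := {α̇ + (k + r·n)·δ | n ∈ ℤ}. Let Λ ⊆ V be a subset such that for every μ ∈ Λ and every α ∈ A: the number 2·B(μ, α)/B(α̇, α̇) is an integer; if this integer is positive then μ − α ∈ Λ; and if it is negative then μ + α ∈ Λ. Suppose λ ∈ Λ satisfies B(λ, δ) ≠ 0 and λ + m·δ ∉ Λ for all m ∈ ℤ_{>0}. Then there exists N ∈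 ℤ_{>0} such that λ + α̇ + n·δ ∉ Λ for every integer n ≥ N. -/
/-- A nonconstant affine function over an Archimedean ordered field is positive at some integer. -/
theorem exists_int_add_mul_pos {K : Type*} [Field K] [LinearOrder K] [IsStrictOrderedRing K]
    [Archimedean K] (a : K) {b : K} (hb : b ≠ 0) : ∃ t : ℤ, 0 < a + (t : K) * b := by
  rcases hb.lt_or_gt with hb | hb
  · obtain ⟨t, ht⟩ := exists_int_lt (-a / b)
    exact ⟨t, by linarith [(lt_div_iff_of_neg hb).mp ht]⟩
  · obtain ⟨t, ht⟩ := exists_int_gt (-a / b)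
    exact ⟨t, by linarith [(div_lt_iff₀ hb).mp ht]⟩


/-- The combinatorial core of Proposition 4.7(ii) of the paper: if `Λ` satisfies the
integrality and string properties with respect to all roots `α̇ + (k + r·n)·δ` (`n ∈ ℤ`),
`B(λ, δ) ≠ 0` and `λ + m·δ ∉ Λ` for all `m ∈ ℤ_{>0}`, then `λ + α̇ + n·δ ∉ Λ` for all
sufficiently large `n`. -/
theorem stmt_7 (V : Type*) [AddCommGroup V] [Module ℝ V]
    (B : V →ₗ[ℝ] V →ₗ[ℝ] ℝ) (hBsymm : ∀ x y : V, B x y = B y x)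
    (δ α' : V)
    (hδδ : B δ δ = 0) (hαδ : B α' δ = 0) (hαα : B α' α' ≠ 0)
    (r : ℤ) (hr : 0 < r) (k : ℤ)
    (A : Set V) (hA : A = {x : V | ∃ n : ℤ, x = α' + (k + r * n) • δ})
    (Λ : Set V)
    (hΛ : ∀ μ ∈ Λ, ∀ α ∈ A, ∃ z : ℤ,
      2 * B μ α / B α' α' = (z : ℝ) ∧
      (0 < z → μ - α ∈ Λ) ∧ (z < 0 → μ + α ∈ Λ))
    (lam : V) (hlam : lam ∈ Λ) (hlamδ : B lam δ ≠ 0)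
    (hstring : ∀ m : ℤ, 0 < m → lam + m • δ ∉ Λ) :
    ∃ N : ℤ, 0 < N ∧ ∀ n : ℤ, N ≤ n → lam + α' + n • δ ∉ Λ := by
  obtain ⟨t, ht⟩ : ∃ t : ℤ, 0 < 2 * B lam α' / B α' α' + 2 + 2 * B lam δ / B α' α' * k
      + (t : ℝ) * (2 * B lam δ / B α' α' * r) :=
    exists_int_add_mul_pos _ (mul_ne_zero (div_ne_zero (mul_ne_zero two_ne_zero hlamδ) hαα)
      (Int.cast_ne_zero.mpr hr.ne'))
  refine ⟨max 1 (k + r * t + 1), by positivity, fun n hn hmem => ?_⟩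
  have hn' : k + r * t + 1 ≤ n := (le_max_right _ _).trans hn
  obtain ⟨z, hz, hpos, -⟩ := hΛ _ hmem (α' + (k + r * t) • δ) (hA ▸ ⟨t, rfl⟩)
  have hδα : B δ α' = 0 := hBsymm δ α' ▸ hαδ
  have hz_pos : (0 : ℝ) < z := by
    rw [← hz]
    convert ht using 1
    simp only [map_add, map_zsmul, LinearMap.add_apply, LinearMap.smul_apply, hδδ, hαδ, hδα,
      zsmul_eq_mul]
    push_cast
    field_simp
    ring
  refine hstring (n - (k + r * t)) (by linarith) ?_
  convert hpos (Int.cast_pos.mp hz_pos) using 1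
  module
end

section
/- Fix ζ ∈ ℚ ∖ ℤ and an irrational real number ξ. Let V be the complex vector space with basis (v_n)_{n ∈ ℤ}, and let H, E, F be the linear endomorphisms of V determined on the basis by H(v_n) = (ζ + 2n)·v_n, E(v_n) = v_{n+1}, and F(v_n) = (1/4)·(ξ − (ζ + 2n − 1)²)·v_{n−1}. Then: (a) the only complex subspaces of V invariant under all three of H, E, F are {0} and V; (b) the set of eigenvalues of H on V is exactly {ζ + 2n | n ∈ ℤ}, and every eigenspace of H is one-dimensional. -/
section DiagonalEndomorphism

variable {ι K : Type*} [Field K] {H : (ι →₀ K) →ₗ[K] (ι →₀ K)} {c : ι → K}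

theorem diagonal_apply (hH : ∀ i, H (Finsupp.single i 1) = c i • Finsupp.single i 1)
    (w : ι →₀ K) (i : ι) : H w i = c i * w i := by
  classical
  have key : Finsupp.lapply i ∘ₗ H = c i • (Finsupp.lapply i : (ι →₀ K) →ₗ[K] K) := by
    ext j
    by_cases h : j = i
    · subst h
      simp [hH]
    · simp [hH, h]
  simpa using LinearMap.congr_fun key w

theorem single_mem_of_diagonal_invariant
    (hH : ∀ i, H (Finsupp.single i 1) = c i • Finsupp.single i 1)
    (hc : Function.Injective c) {W : Submodule K (ι →₀ K)} (hW : ∀ w ∈ W, H w ∈ W)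
    {w : ι →₀ K} (hw : w ∈ W) {i : ι} (hi : w i ≠ 0) : Finsupp.single i 1 ∈ W := by
  classical
  suffices key : ∀ (s : Finset ι) (w : ι →₀ K), w ∈ W → w i ≠ 0 →
      (∀ j, j ≠ i → j ∉ s → w j = 0) → Finsupp.single i 1 ∈ W from
    key w.support w hw hi fun j _ hj => Finsupp.notMem_support_iff.mp hj
  intro s
  induction s using Finset.induction_on with
  | empty =>
    intro w hw hi hs
    have h : Finsupp.single i 1 = (w i)⁻¹ • w := by
      ext j
      by_cases hj : j = i
      · subst hj
        simp [hi]
      · simp [hs j hj (Finset.notMem_empty j), Ne.symm hj]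
    rw [h]
    exact W.smul_mem _ hw
  | insert m s _ ih =>
    intro w hw hi hs
    by_cases hm : m = i
    · refine ih w hw hi fun j hj hjs => hs j hj ?_
      simp [hm, hj, hjs]
    · refine ih (H w - c m • w) (W.sub_mem (hW w hw) (W.smul_mem _ hw)) ?_ ?_
      · simp only [Finsupp.sub_apply, Finsupp.smul_apply, diagonal_apply hH, smul_eq_mul,
          ← sub_mul]
        exact mul_ne_zero (sub_ne_zero.mpr fun h => hm (hc h).symm) hi
      · intro j hj hjs
        simp only [Finsupp.sub_apply, Finsupp.smul_apply, diagonal_apply hH, smul_eq_mul,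
          ← sub_mul]
        by_cases hjm : j = m
        · simp [hjm]
        · rw [hs j hj (by simp [hjm, hjs]), mul_zero]

theorem eigenspace_diagonal (hH : ∀ i, H (Finsupp.single i 1) = c i • Finsupp.single i 1)
    (hc : Function.Injective c) (i : ι) :
    Module.End.eigenspace (H : Module.End K (ι →₀ K)) (c i) =
      Submodule.span K {Finsupp.single i 1} := by
  classical
  refine le_antisymm (fun w hw => ?_) ?_
  · rw [Module.End.mem_eigenspace_iff] at hw
    refine Submodule.mem_span_singleton.mpr ⟨w i, ?_⟩
    ext j
    by_cases hj : j = i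
    · subst hj
      simp
    · have h := DFunLike.congr_fun hw j
      rw [diagonal_apply hH, Finsupp.smul_apply, smul_eq_mul] at h
      have hwj : w j = 0 := by
        by_contra h0
        exact hj (hc (mul_right_cancel₀ h0 h))
      simp [hwj, Ne.symm hj]
  · rw [Submodule.span_singleton_le_iff_mem, Module.End.mem_eigenspace_iff]
    exact hH i

theorem eigenspace_diagonal_ne_bot_iff
    (hH : ∀ i, H (Finsupp.single i 1) = c i • Finsupp.single i 1)
    (hc : Function.Injective c) (μ : K) :
    Module.End.eigenspace (H : Module.End K (ι →₀ K)) μ ≠ ⊥ ↔ ∃ i, μ = c i := by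
  constructor
  · intro h
    obtain ⟨w, hw, hw0⟩ := Submodule.exists_mem_ne_zero_of_ne_bot h
    obtain ⟨i, hi⟩ := Finsupp.ne_iff.mp hw0
    rw [Module.End.mem_eigenspace_iff] at hw
    have h := DFunLike.congr_fun hw i
    rw [diagonal_apply hH, Finsupp.smul_apply, smul_eq_mul] at h
    exact ⟨i, (mul_right_cancel₀ hi h).symm⟩
  · rintro ⟨i, rfl⟩
    rw [eigenspace_diagonal hH hc, Ne, Submodule.span_singleton_eq_bot]
    simp

end DiagonalEndomorphism

theorem weighted_shift_coeff_ne_zero (ζ : ℚ) {ξ : ℝ} (hξ : Irrational ξ) (n : ℤ) :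
    (1 / 4 : ℂ) * ((ξ : ℂ) - ((ζ : ℂ) + 2 * (n : ℂ) - 1) ^ 2) ≠ 0 := by
  refine mul_ne_zero (by norm_num) (sub_ne_zero.mpr fun h => ?_)
  refine hξ ⟨(ζ + 2 * n - 1) ^ 2, ?_⟩
  have h' : ξ = ((ζ : ℝ) + 2 * (n : ℝ) - 1) ^ 2 := by exact_mod_cast h
  rw [h']
  push_cast
  rfl

/-- The module `K₁` of the Example of the paper: (a) it is irreducible under `H`, `E`, `F`;
(b) the set of eigenvalues of `H` is exactly `{ζ + 2n | n ∈ ℤ}` and every eigenspace of `H`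
is one-dimensional. -/
theorem stmt_9 (ζ : ℚ) (hζ : ∀ n : ℤ, ζ ≠ (n : ℚ))
    (ξ : ℝ) (hξ : Irrational ξ)
    (H E F : (ℤ →₀ ℂ) →ₗ[ℂ] (ℤ →₀ ℂ))
    (hH : ∀ n : ℤ, H (Finsupp.single n 1) =
      ((ζ : ℂ) + 2 * (n : ℂ)) • Finsupp.single n 1)
    (hE : ∀ n : ℤ, E (Finsupp.single n 1) = Finsupp.single (n + 1) 1)
    (hF : ∀ n : ℤ, F (Finsupp.single n 1) =
      ((1 / 4 : ℂ) * ((ξ : ℂ) - ((ζ : ℂ) + 2 * (n : ℂ) - 1) ^ 2)) •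
        Finsupp.single (n - 1) 1) :
    (∀ W : Submodule ℂ (ℤ →₀ ℂ),
      (∀ w ∈ W, H w ∈ W) → (∀ w ∈ W, E w ∈ W) → (∀ w ∈ W, F w ∈ W) →
      W = ⊥ ∨ W = ⊤) ∧
    (∀ μ : ℂ, Module.End.eigenspace (H : Module.End ℂ (ℤ →₀ ℂ)) μ ≠ ⊥ ↔
      ∃ n : ℤ, μ = (ζ : ℂ) + 2 * (n : ℂ)) ∧
    (∀ μ : ℂ, Module.End.eigenspace (H : Module.End ℂ (ℤ →₀ ℂ)) μ ≠ ⊥ →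
      Module.finrank ℂ (Module.End.eigenspace (H : Module.End ℂ (ℤ →₀ ℂ)) μ) = 1) := by
  have hc : Function.Injective fun n : ℤ => (ζ : ℂ) + 2 * (n : ℂ) := fun m n h => by
    simpa using h
  refine ⟨fun W hWH hWE hWF => or_iff_not_imp_left.mpr fun hW => ?_,
    eigenspace_diagonal_ne_bot_iff hH hc, fun μ hμ => ?_⟩
  · obtain ⟨w, hw, hw0⟩ := Submodule.exists_mem_ne_zero_of_ne_bot hW
    obtain ⟨i, hi⟩ := Finsupp.ne_iff.mp hw0
    have hmem : ∀ n : ℤ, Finsupp.single n (1 : ℂ) ∈ W := fun n => by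
      induction n using Int.inductionOn' (b := i) with
      | zero => exact single_mem_of_diagonal_invariant hH hc hWH hw hi
      | succ k _ ih => exact hE k ▸ hWE _ ih
      | pred k _ ih =>
        have h := hWF _ ih
        rw [hF] at h
        exact (W.smul_mem_iff (weighted_shift_coeff_ne_zero ζ hξ k)).mp h
    refine eq_top_iff.mpr fun v _ => ?_
    rw [← Finsupp.sum_single v]
    refine W.sum_mem fun n _ => ?_
    simpa using W.smul_mem (v n) (hmem n)
  · obtain ⟨n, rfl⟩ := (eigenspace_diagonal_ne_bot_iff hH hc μ).mp hμ
    rw [eigenspace_diagonal hH hc n]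
    exact finrank_span_singleton (by simp)
end

section
/- Let k, ℓ be positive integers and let V := ℝ^{k+ℓ+1} with standard basis vectors ε₁, …, ε_k, δ₁, …, δ_ℓ, δ. Let R ⊆ V be the root system of type A(2k, 2ℓ−1)^{(2)}: R = ℤδ ∪ {±ε_i + mδ | 1 ≤ i ≤ k, m ∈ ℤ} ∪ {±δ_j + mδ | 1 ≤ j ≤ ℓ, m ∈ ℤ} ∪ {±ε_i ± ε_r + mδ | 1 ≤ i ≠ r ≤ k, m ∈ ℤ} ∪ {±δ_j ± δ_s + mδ | 1 ≤ j ≠ s ≤ ℓ, m ∈ ℤ} ∪ {±ε_i ± δ_j + mδ | m ∈ ℤ} ∪ {±2ε_i + mδ | m odd} ∪ {±2δ_j + mδ | m even}. Define R(1) := I₁ ∪ {±(δ_j ± δ_s) + mδ | 1 ≤ j ≠ s ≤ ℓ, m ∈ ℤ} ∪ {±2δ_j + mδ | m even}, where I₁ = 2ℤδ if ℓ = 1 and I₁ = ℤδ if ℓ ≥ 2, and R(2) := ℤδ ∪ {±ε_i + mδ | m ∈ ℤ} ∪ {±(ε_i ± ε_r) + mδ | i ≠ r, m ∈ ℤ}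 ∪ {±2ε_i + mδ | m odd}. Set S(1) := ℤδ ∪ R(1) ∪ {α ∈ R | 2α ∈ R(1)} and S(2) := ℤδ ∪ R(2) ∪ {α ∈ R | 2α ∈ R(2)}. Then S(1) = R ∩ span_ℝ{δ, δ₁, …, δ_ℓ} and S(2) = R ∩ span_ℝ{δ, ε₁, …, ε_k}; in particular both S(1) and S(2) are closed subsets of R, i.e. (S(i) + S(i)) ∩ R ⊆ S(i) for i = 1, 2. -/
theorem mem_span_zero_one_union_range_snd {m n : Type*} [DecidableEq n] [Fintype n]
    (x : (m → ℝ) × (n → ℝ) × ℝ) :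
    x ∈ Submodule.span ℝ ({((0, 0, 1) : (m → ℝ) × (n → ℝ) × ℝ)} ∪
      Set.range fun j : n => ((0, Pi.single j 1, 0) : (m → ℝ) × (n → ℝ) × ℝ)) ↔ x.1 = 0 := by
  constructor
  · intro hx
    have hle : Submodule.span ℝ ({((0, 0, 1) : (m → ℝ) × (n → ℝ) × ℝ)} ∪
        Set.range fun j : n => ((0, Pi.single j 1, 0) : (m → ℝ) × (n → ℝ) × ℝ)) ≤
        LinearMap.ker (LinearMap.fst ℝ (m → ℝ) ((n → ℝ) × ℝ)) := by
      rw [Submodule.span_le]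
      rintro y (rfl | ⟨j, rfl⟩) <;> simp
    exact hle hx
  · intro hx
    have hsum : x = x.2.2 • ((0, 0, 1) : (m → ℝ) × (n → ℝ) × ℝ) +
        ∑ j, x.2.1 j • ((0, Pi.single j 1, 0) : (m → ℝ) × (n → ℝ) × ℝ) := by
      refine Prod.ext ?_ (Prod.ext ?_ ?_)
      · simp [hx, Prod.fst_sum]
      · ext t
        simp [Prod.fst_sum, Prod.snd_sum, Pi.single_apply]
      · simp [Prod.snd_sum]
    rw [hsum]
    exact add_mem (Submodule.smul_mem _ _ (Submodule.subset_span (Or.inl rfl)))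
      (sum_mem fun j _ => Submodule.smul_mem _ _ (Submodule.subset_span (Or.inr ⟨j, rfl⟩)))

theorem mem_span_zero_one_union_range_fst {m n : Type*} [DecidableEq m] [Fintype m]
    (x : (m → ℝ) × (n → ℝ) × ℝ) :
    x ∈ Submodule.span ℝ ({((0, 0, 1) : (m → ℝ) × (n → ℝ) × ℝ)} ∪
      Set.range fun i : m => ((Pi.single i 1, 0, 0) : (m → ℝ) × (n → ℝ) × ℝ)) ↔ x.2.1 = 0 := by
  constructor
  · intro hx
    have hle : Submodule.span ℝ ({((0, 0, 1) : (m → ℝ) × (n → ℝ) × ℝ)} ∪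
        Set.range fun i : m => ((Pi.single i 1, 0, 0) : (m → ℝ) × (n → ℝ) × ℝ)) ≤
        LinearMap.ker (LinearMap.fst ℝ (n → ℝ) ℝ ∘ₗ LinearMap.snd ℝ (m → ℝ) ((n → ℝ) × ℝ)) := by
      rw [Submodule.span_le]
      rintro y (rfl | ⟨j, rfl⟩) <;> simp
    exact hle hx
  · intro hx
    have hsum : x = x.2.2 • ((0, 0, 1) : (m → ℝ) × (n → ℝ) × ℝ) +
        ∑ i, x.1 i • ((Pi.single i 1, 0, 0) : (m → ℝ) × (n → ℝ) × ℝ) := by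
      refine Prod.ext ?_ (Prod.ext ?_ ?_)
      · ext t
        simp [Prod.fst_sum, Pi.single_apply]
      · simp [hx, Prod.snd_sum]
      · simp [Prod.snd_sum]
    rw [hsum]
    exact add_mem (Submodule.smul_mem _ _ (Submodule.subset_span (Or.inl rfl)))
      (sum_mem fun i _ => Submodule.smul_mem _ _ (Submodule.subset_span (Or.inr ⟨i, rfl⟩)))

theorem smul_single_ne_zero {n : Type*} [DecidableEq n] {a : ℝ} (ha : a ∈ ({1, -1} : Set ℝ))
    (i : n) : a • (Pi.single i 1 : n → ℝ) ≠ 0 := by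
  intro h
  have := congrFun h i
  rcases ha with rfl | rfl <;> simp at this

theorem smul_single_add_smul_single_ne_zero {n : Type*} [DecidableEq n] {a : ℝ}
    (ha : a ∈ ({1, -1} : Set ℝ)) (b : ℝ) {i r : n} (hir : i ≠ r) :
    a • (Pi.single i 1 : n → ℝ) + b • (Pi.single r 1 : n → ℝ) ≠ 0 := by
  intro h
  have := congrFun h i
  rcases ha with rfl | rfl <;> simp [hir] at this

theorem two_mul_smul_single_ne_zero {n : Type*} [DecidableEq n] {a : ℝ}
    (ha : a ∈ ({1, -1} : Set ℝ)) (i : n) : (2 * a) • (Pi.single i 1 : n → ℝ) ≠ 0 := by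
  rw [mul_smul]
  exact smul_ne_zero two_ne_zero (smul_single_ne_zero ha i)

/-- For the root system `R` of type `A(2k, 2ℓ−1)^{(2)}` with even-part components `R(1)`,
`R(2)` and `S(i) := ℤδ ∪ R(i) ∪ (R ∩ ½R(i))`, one has `S(1) = R ∩ span_ℝ{δ, δ₁, …, δ_ℓ}` and
`S(2) = R ∩ span_ℝ{δ, ε₁, …, ε_k}`; in particular `S(1)` and `S(2)` are closed subsets of
`R`. -/
theorem stmt_10 (k ℓ : ℕ) (hk : 0 < k) (hℓ : 0 < ℓ)
    (ε : Fin k → (Fin k → ℝ) × (Fin ℓ → ℝ) × ℝ)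
    (hε : ∀ i, ε i = (Pi.single i 1, 0, 0))
    (d : Fin ℓ → (Fin k → ℝ) × (Fin ℓ → ℝ) × ℝ)
    (hd : ∀ j, d j = (0, Pi.single j 1, 0))
    (δ : (Fin k → ℝ) × (Fin ℓ → ℝ) × ℝ) (hδ : δ = (0, 0, 1))
    (R R1 R2 S1 S2 : Set ((Fin k → ℝ) × (Fin ℓ → ℝ) × ℝ))
    (hR : R = {x | ∃ m : ℤ, x = (m : ℝ) • δ}
      ∪ {x | ∃ a ∈ ({1, -1} : Set ℝ), ∃ i : Fin k, ∃ m : ℤ,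
          x = a • ε i + (m : ℝ) • δ}
      ∪ {x | ∃ a ∈ ({1, -1} : Set ℝ), ∃ j : Fin ℓ, ∃ m : ℤ,
          x = a • d j + (m : ℝ) • δ}
      ∪ {x | ∃ a ∈ ({1, -1} : Set ℝ), ∃ b ∈ ({1, -1} : Set ℝ), ∃ i r : Fin k,
          i ≠ r ∧ ∃ m : ℤ, x = a • ε i + b • ε r + (m : ℝ) • δ}
      ∪ {x | ∃ a ∈ ({1, -1} : Set ℝ), ∃ b ∈ ({1, -1} : Set ℝ), ∃ j s : Fin ℓ,
          j ≠ s ∧ ∃ m : ℤ, x = a • d j + b • d s + (m : ℝ) • δ}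
      ∪ {x | ∃ a ∈ ({1, -1} : Set ℝ), ∃ b ∈ ({1, -1} : Set ℝ), ∃ i : Fin k,
          ∃ j : Fin ℓ, ∃ m : ℤ, x = a • ε i + b • d j + (m : ℝ) • δ}
      ∪ {x | ∃ a ∈ ({1, -1} : Set ℝ), ∃ i : Fin k, ∃ m : ℤ,
          Odd m ∧ x = (2 * a) • ε i + (m : ℝ) • δ}
      ∪ {x | ∃ a ∈ ({1, -1} : Set ℝ), ∃ j : Fin ℓ, ∃ m : ℤ,
          Even m ∧ x = (2 * a) • d j + (m : ℝ) • δ})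
    (hR1 : R1 = {x | ∃ m : ℤ, (ℓ = 1 → Even m) ∧ x = (m : ℝ) • δ}
      ∪ {x | ∃ a ∈ ({1, -1} : Set ℝ), ∃ b ∈ ({1, -1} : Set ℝ), ∃ j s : Fin ℓ,
          j ≠ s ∧ ∃ m : ℤ, x = a • d j + b • d s + (m : ℝ) • δ}
      ∪ {x | ∃ a ∈ ({1, -1} : Set ℝ), ∃ j : Fin ℓ, ∃ m : ℤ,
          Even m ∧ x = (2 * a) • d j + (m : ℝ) • δ})
    (hR2 : R2 = {x | ∃ m : ℤ, x = (m : ℝ) • δ}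
      ∪ {x | ∃ a ∈ ({1, -1} : Set ℝ), ∃ i : Fin k, ∃ m : ℤ,
          x = a • ε i + (m : ℝ) • δ}
      ∪ {x | ∃ a ∈ ({1, -1} : Set ℝ), ∃ b ∈ ({1, -1} : Set ℝ), ∃ i r : Fin k,
          i ≠ r ∧ ∃ m : ℤ, x = a • ε i + b • ε r + (m : ℝ) • δ}
      ∪ {x | ∃ a ∈ ({1, -1} : Set ℝ), ∃ i : Fin k, ∃ m : ℤ,
          Odd m ∧ x = (2 * a) • ε i + (m : ℝ) • δ})
    (hS1 : S1 = {x | ∃ m : ℤ, x = (m : ℝ) • δ} ∪ R1 ∪ {α ∈ R | (2 : ℝ) • α ∈ R1})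
    (hS2 : S2 = {x | ∃ m : ℤ, x = (m : ℝ) • δ} ∪ R2 ∪ {α ∈ R | (2 : ℝ) • α ∈ R2}) :
    S1 = R ∩ ↑(Submodule.span ℝ ({δ} ∪ Set.range d)) ∧
    S2 = R ∩ ↑(Submodule.span ℝ ({δ} ∪ Set.range ε)) ∧
    (∀ a ∈ S1, ∀ b ∈ S1, a + b ∈ R → a + b ∈ S1) ∧
    (∀ a ∈ S2, ∀ b ∈ S2, a + b ∈ R → a + b ∈ S2) := by
  obtain rfl : ε = fun i => (Pi.single i 1, 0, 0) := funext hε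
  obtain rfl : d = fun j => (0, Pi.single j 1, 0) := funext hd
  subst hδ
  have hδR : ∀ m : ℤ, (m : ℝ) • ((0, 0, 1) : (Fin k → ℝ) × (Fin ℓ → ℝ) × ℝ) ∈ R := fun m => by
    rw [hR]
    exact Or.inl <| Or.inl <| Or.inl <| Or.inl <| Or.inl <| Or.inl <| Or.inl ⟨m, rfl⟩
  have hR1R : R1 ⊆ R := by
    rw [hR1]
    rintro x ((⟨m, -, rfl⟩ | h) | h)
    · exact hδR m
    · rw [hR]
      exact Or.inl <| Or.inl <| Or.inl <| Or.inr h
    · rw [hR]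
      exact Or.inr h
  have hR2R : R2 ⊆ R := by
    rw [hR2]
    rintro x (((⟨m, rfl⟩ | h) | h) | h)
    · exact hδR m
    · rw [hR]
      exact Or.inl <| Or.inl <| Or.inl <| Or.inl <| Or.inl <| Or.inl <| Or.inr h
    · rw [hR]
      exact Or.inl <| Or.inl <| Or.inl <| Or.inl <| Or.inr h
    · rw [hR]
      exact Or.inl <| Or.inr h
  have hR1z : ∀ x ∈ R1, x.1 = 0 := by
    rw [hR1]
    rintro x ((⟨m, -, rfl⟩ | ⟨a, -, b, -, j, s, -, m, rfl⟩) | ⟨a, -, j, m, -, rfl⟩) <;> simp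
  have hR2z : ∀ x ∈ R2, x.2.1 = 0 := by
    rw [hR2]
    rintro x (((⟨m, rfl⟩ | ⟨a, -, i, m, rfl⟩) | ⟨a, -, b, -, i, r, -, m, rfl⟩) |
      ⟨a, -, i, m, -, rfl⟩) <;> simp
  have hS1R : S1 = R ∩ {x | x.1 = 0} := by
    subst hS1
    apply Set.Subset.antisymm
    · rintro x ((⟨m, rfl⟩ | h) | ⟨hx, h⟩)
      · exact ⟨hδR m, by simp⟩
      · exact ⟨hR1R h, hR1z x h⟩
      · exact ⟨hx, by simpa using hR1z _ h⟩
    · rintro x ⟨hx, hz⟩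
      have hx' := hx
      rw [hR] at hx'
      rcases hx' with ((((((h | ⟨a, ha, i, m, rfl⟩) | ⟨a, ha, j, m, rfl⟩) |
        ⟨a, ha, b, -, i, r, hir, m, rfl⟩) | h) | ⟨a, ha, b, -, i, j, m, rfl⟩) |
        ⟨a, ha, i, m, -, rfl⟩) | h
      · exact Or.inl (Or.inl h)
      · exact absurd (by simpa using hz) (smul_single_ne_zero ha i)
      · refine Or.inr ⟨hx, ?_⟩
        rw [hR1]
        refine Or.inr ⟨a, ha, j, 2 * m, even_two_mul m, ?_⟩
        rw [smul_add, smul_smul, smul_smul]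
        push_cast
        rfl
      · exact absurd (by simpa using hz) (smul_single_add_smul_single_ne_zero ha b hir)
      · exact Or.inl (Or.inr (hR1 ▸ Or.inl (Or.inr h)))
      · exact absurd (by simpa using hz) (smul_single_ne_zero ha i)
      · exact absurd (by simpa using hz) (two_mul_smul_single_ne_zero ha i)
      · exact Or.inl (Or.inr (hR1 ▸ Or.inr h))
  have hS2R : S2 = R ∩ {x | x.2.1 = 0} := by
    subst hS2
    apply Set.Subset.antisymm
    · rintro x ((⟨m, rfl⟩ | h) | ⟨hx, h⟩)
      · exact ⟨hδR m, by simp⟩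
      · exact ⟨hR2R h, hR2z x h⟩
      · exact ⟨hx, by simpa using hR2z _ h⟩
    · rintro x ⟨hx, hz⟩
      rw [hR] at hx
      rcases hx with ((((((h | h) | ⟨a, ha, j, m, rfl⟩) | h) |
        ⟨a, ha, b, -, j, s, hjs, m, rfl⟩) | ⟨a, -, b, hb, i, j, m, rfl⟩) | h) |
        ⟨a, ha, j, m, -, rfl⟩
      · exact Or.inl (Or.inl h)
      · exact Or.inl (Or.inr (hR2 ▸ Or.inl (Or.inl (Or.inr h))))
      · exact absurd (by simpa using hz) (smul_single_ne_zero ha j)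
      · exact Or.inl (Or.inr (hR2 ▸ Or.inl (Or.inr h)))
      · exact absurd (by simpa using hz) (smul_single_add_smul_single_ne_zero ha b hjs)
      · exact absurd (by simpa using hz) (smul_single_ne_zero hb j)
      · exact Or.inl (Or.inr (hR2 ▸ Or.inr h))
      · exact absurd (by simpa using hz) (two_mul_smul_single_ne_zero ha j)
  refine ⟨?_, ?_, ?_, ?_⟩
  · rw [hS1R]
    ext x
    exact and_congr_right fun _ => (mem_span_zero_one_union_range_snd x).symm
  · rw [hS2R]
    ext x
    exact and_congr_right fun _ => (mem_span_zero_one_union_range_fst x).symm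
  · rw [hS1R]
    rintro a ⟨-, ha⟩ b ⟨-, hb⟩ hab
    exact ⟨hab, (congrArg₂ (· + ·) ha hb).trans (add_zero 0)⟩
  · rw [hS2R]
    rintro a ⟨-, ha⟩ b ⟨-, hb⟩ hab
    exact ⟨hab, (congrArg₂ (· + ·) ha hb).trans (add_zero 0)⟩
end

section
/- Let k ≥ 2 be an integer and let V := ℝ^{k+2} with standard basis vectors ε₁, …, ε_k, δ₁, δ. Let R ⊆ V be the root system of type A(2k−1, 1)^{(2)}: R = ℤδ ∪ {±2δ₁ + 2mδ | m ∈ ℤ} ∪ {±ε_i ± δ₁ + mδ | 1 ≤ i ≤ k, m ∈ ℤ} ∪ {±2ε_i + (2m+1)δ | 1 ≤ i ≤ k, m ∈ ℤ} ∪ {±ε_i ± ε_j + mδ | 1 ≤ i < j ≤ k, m ∈ ℤ}. Let Δ := {−2δ₁, δ₁ + ε_k, ε_{i−1} − ε_i (2 ≤ i ≤ k), δ − 2ε₁} ⊆ V. Then Δ is a linearly independent subset of V and R ⊆ span_{ℤ≥0} Δ ∪ span_{ℤ≤0} Δ, i.e. every element of R is a linear combination of the elements of Δ with coefficients that are either all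 nonnegative integers or all nonpositive integers. -/
/-- Telescoping: if consecutive differences of a finite sequence lie in an additive submonoid,
then so do all differences `f i - f j` with `i ≤ j`. -/
theorem sub_mem_of_consecutive_sub_mem {V : Type*} [AddCommGroup V] {M : AddSubmonoid V} {k : ℕ}
    {f : Fin k → V}
    (hf : ∀ (n : ℕ) (hn : n + 1 < k), f ⟨n, by omega⟩ - f ⟨n + 1, hn⟩ ∈ M)
    {i j : Fin k} (hij : i ≤ j) : f i - f j ∈ M := by
  obtain ⟨i, hi⟩ := i
  obtain ⟨j, hj⟩ := j
  induction j, (show i ≤ j from hij) using Nat.le_induction with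
  | base => simp
  | succ n hin ih =>
    have := M.add_mem (ih (by omega) hin) (hf n hj)
    rwa [sub_add_sub_cancel] at this

/-- If `α` and `β - α` lie in an additive submonoid `M`, then every `α + m β` with `m` an
integer lies in `M` or in `-M`. -/
theorem add_zsmul_mem_or_neg_mem {V : Type*} [AddCommGroup V] {M : AddSubmonoid V} {α β : V}
    (hα : α ∈ M) (hβ : β - α ∈ M) (m : ℤ) : α + m • β ∈ M ∨ -(α + m • β) ∈ M := by
  have hβM : β ∈ M := by simpa using M.add_mem hβ hα
  obtain ⟨n, rfl | rfl⟩ : ∃ n : ℕ, m = n ∨ m = -(n + 1) := by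
    rcases le_or_gt 0 m with h | h
    · exact ⟨m.toNat, by omega⟩
    · exact ⟨(-m - 1).toNat, by omega⟩
  · left
    rw [natCast_zsmul]
    exact M.add_mem hα (M.nsmul_mem hβM n)
  · right
    convert M.add_mem hβ (M.nsmul_mem hβM n) using 1
    module

/-- The version of `add_zsmul_mem_or_neg_mem` with the sign of `α` free. -/
theorem smul_add_zsmul_mem_or_neg_mem {V : Type*} [AddCommGroup V] [Module ℝ V]
    {M : AddSubmonoid V} {α β : V} (hα : α ∈ M) (hβ : β - α ∈ M) {a : ℝ}
    (ha : a ∈ ({1, -1} : Set ℝ)) (m : ℤ) :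
    a • α + (m : ℝ) • β ∈ M ∨ -(a • α + (m : ℝ) • β) ∈ M := by
  rw [Int.cast_smul_eq_zsmul]
  rcases ha with rfl | rfl
  · simpa using add_zsmul_mem_or_neg_mem hα hβ m
  · have h := (add_zsmul_mem_or_neg_mem hα hβ (-m)).symm
    have e : (-1 : ℝ) • α + m • β = -(α + (-m) • β) := by module
    rwa [e, neg_neg]

/-- Step 3 of the Example of the paper: for the root system `R` of `A(2k−1, 1)^{(2)}`
(`k ≥ 2`), the set `Δ = {−2δ₁, δ₁ + ε_k, ε_{i−1} − ε_i (2 ≤ i ≤ k), δ − 2ε₁}` is linearly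
independent and `R ⊆ span_{ℤ≥0} Δ ∪ span_{ℤ≤0} Δ`. -/
theorem stmt_11 (k : ℕ) (hk : 2 ≤ k)
    (ε : Fin k → (Fin k → ℝ) × ℝ × ℝ)
    (hε : ∀ i, ε i = (Pi.single i 1, 0, 0))
    (δ₁ : (Fin k → ℝ) × ℝ × ℝ) (hδ₁ : δ₁ = (0, 1, 0))
    (δ : (Fin k → ℝ) × ℝ × ℝ) (hδ : δ = (0, 0, 1))
    (R : Set ((Fin k → ℝ) × ℝ × ℝ))
    (hR : R = {x | ∃ m : ℤ, x = (m : ℝ) • δ}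
      ∪ {x | ∃ a ∈ ({1, -1} : Set ℝ), ∃ m : ℤ,
          x = (2 * a) • δ₁ + ((2 * m : ℤ) : ℝ) • δ}
      ∪ {x | ∃ a ∈ ({1, -1} : Set ℝ), ∃ b ∈ ({1, -1} : Set ℝ), ∃ i : Fin k,
          ∃ m : ℤ, x = a • ε i + b • δ₁ + (m : ℝ) • δ}
      ∪ {x | ∃ a ∈ ({1, -1} : Set ℝ), ∃ i : Fin k, ∃ m : ℤ,
          x = (2 * a) • ε i + ((2 * m + 1 : ℤ) : ℝ) • δ}
      ∪ {x | ∃ a ∈ ({1, -1} : Set ℝ), ∃ b ∈ ({1, -1} : Set ℝ), ∃ i j : Fin k,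
          i < j ∧ ∃ m : ℤ, x = a • ε i + b • ε j + (m : ℝ) • δ})
    (g : Fin (k + 2) → (Fin k → ℝ) × ℝ × ℝ)
    (hg0 : g ⟨0, by omega⟩ = -((2 : ℝ) • δ₁))
    (hg1 : g ⟨1, by omega⟩ = δ₁ + ε ⟨k - 1, by omega⟩)
    (hgmid : ∀ j : ℕ, ∀ h2 : 2 ≤ j, ∀ hjk : j ≤ k,
      g ⟨j, by omega⟩ = ε ⟨j - 2, by omega⟩ - ε ⟨j - 1, by omega⟩)
    (hglast : g ⟨k + 1, by omega⟩ = δ - (2 : ℝ) • ε ⟨0, by omega⟩) :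
    LinearIndependent ℝ g ∧
    ∀ x ∈ R, (∃ c : Fin (k + 2) → ℕ, x = ∑ j, (c j : ℝ) • g j) ∨
      (∃ c : Fin (k + 2) → ℕ, x = -∑ j, (c j : ℝ) • g j) := by
  set M : Submodule ℕ ((Fin k → ℝ) × ℝ × ℝ) := Submodule.span ℕ (Set.range g) with hM
  have hgM (j) : g j ∈ M := Submodule.subset_span ⟨j, rfl⟩
  have hneg : -((2 : ℝ) • δ₁) ∈ M := hg0 ▸ hgM _
  have hsub {i j : Fin k} (hij : i ≤ j) : ε i - ε j ∈ M := by
    refine sub_mem_of_consecutive_sub_mem (M := M.toAddSubmonoid) (fun n hn => ?_) hij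
    have := hgM ⟨n + 2, by omega⟩
    rwa [hgmid (n + 2) (by omega) (by omega)] at this
  have hadd (i : Fin k) : ε i + δ₁ ∈ M := by
    have hi : ε i - ε ⟨k - 1, by omega⟩ ∈ M := hsub (Fin.mk_le_mk.2 (by omega))
    convert M.add_mem (hg1 ▸ hgM _) hi using 1
    module
  have hdiff (i : Fin k) : ε i - δ₁ ∈ M := by
    convert M.add_mem (hadd i) hneg using 1
    module
  have hsum (i j : Fin k) : ε i + ε j ∈ M := by
    convert M.add_mem (hadd i) (hdiff j) using 1
    module
  have hδε (i : Fin k) : δ - (2 : ℝ) • ε i ∈ M := by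
    have h0 : ε ⟨0, by omega⟩ - ε i ∈ M := hsub (Fin.mk_le_mk.2 (Nat.zero_le _))
    convert M.add_mem (hglast ▸ hgM _) (M.add_mem h0 h0) using 1
    module
  have hδM : δ ∈ M := by
    convert M.add_mem (hδε ⟨0, by omega⟩) (hsum ⟨0, by omega⟩ ⟨0, by omega⟩) using 1
    module
  constructor
  · refine linearIndependent_of_top_le_span_of_card_eq_finrank ?_ (by simp)
    set N := Submodule.span ℝ (Set.range g)
    have hMN {x} (hx : x ∈ M) : x ∈ N := Submodule.span_le_restrictScalars ℕ ℝ _ hx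
    have h1 : δ₁ ∈ N := by
      convert N.smul_mem (-1 / 2 : ℝ) (hMN hneg) using 1
      module
    have hε' (i : Fin k) : ε i ∈ N := by
      simpa using N.sub_mem (hMN (hadd i)) h1
    rintro ⟨x, y, z⟩ -
    have hx : ((x, y, z) : (Fin k → ℝ) × ℝ × ℝ) = ∑ i, x i • ε i + y • δ₁ + z • δ := by
      simp only [hε, hδ₁, hδ]
      ext <;> simp [Prod.fst_sum, Prod.snd_sum, Finset.sum_apply, Pi.single_apply]
    rw [hx]
    exact N.add_mem (N.add_mem (N.sum_mem fun i _ => N.smul_mem _ (hε' i)) (N.smul_mem _ h1))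
      (N.smul_mem _ (hMN hδM))
  · intro x hxR
    suffices h : x ∈ M ∨ -x ∈ M by
      simp only [hM, Submodule.mem_span_range_iff_exists_fun] at h
      simp only [Nat.cast_smul_eq_nsmul]
      exact h.imp (fun ⟨c, hc⟩ => ⟨c, hc.symm⟩) (fun ⟨c, hc⟩ => ⟨c, by rw [hc, neg_neg]⟩)
    have key {α β : (Fin k → ℝ) × ℝ × ℝ} (hα : α ∈ M) (hβ : β - α ∈ M) {a : ℝ}
        (ha : a ∈ ({1, -1} : Set ℝ)) (m : ℤ) (hx : x = a • α + (m : ℝ) • β) :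
        x ∈ M ∨ -x ∈ M :=
      hx ▸ smul_add_zsmul_mem_or_neg_mem (M := M.toAddSubmonoid) hα hβ ha m
    subst hR
    rcases hxR with (((⟨m, hx⟩ | ⟨a, ha, m, hx⟩) | ⟨a, ha, b, hb, i, m, hx⟩) | ⟨a, ha, i, m, hx⟩) |
      ⟨a, ha, b, hb, i, j, hij, m, hx⟩
    · exact key M.zero_mem (by simpa using hδM) (Or.inl rfl) m (by simpa using hx)
    · have hβ : (2 : ℝ) • δ - -((2 : ℝ) • δ₁) ∈ M := by
        let i : Fin k := ⟨0, by omega⟩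
        convert M.add_mem (M.add_mem (hδε i) hδM) (M.add_mem (hadd i) (hadd i)) using 1
        module
      refine key hneg hβ (a := -a) (by simpa [neg_eq_iff_eq_neg, or_comm] using ha) m ?_
      rw [hx]
      push_cast
      module
    · have hαM : ε i + (a * b) • δ₁ ∈ M ∧ δ - (ε i + (a * b) • δ₁) ∈ M := by
        have hab : a * b = 1 ∨ a * b = -1 := by
          rcases ha with rfl | rfl <;> rcases hb with rfl | rfl <;> simp
        rcases hab with h | h <;> rw [h]
        · refine ⟨by simpa using hadd i, ?_⟩
          convert M.add_mem (hδε i) (hdiff i) using 1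
          module
        · refine ⟨by simpa [sub_eq_add_neg] using hdiff i, ?_⟩
          convert M.add_mem (hδε i) (hadd i) using 1
          module
      refine key hαM.1 hαM.2 ha m ?_
      rw [hx]
      rcases ha with rfl | rfl <;> module
    · have hβ : δ - (ε i + ε i) ∈ M := by
        convert hδε i using 1
        module
      refine key (hsum i i) hβ ha (2 * m + 1) ?_
      rw [hx]
      module
    · have hαM : ε i + (a * b) • ε j ∈ M ∧ δ - (ε i + (a * b) • ε j) ∈ M := by
        have hab : a * b = 1 ∨ a * b = -1 := by
          rcases ha with rfl | rfl <;> rcases hb with rfl | rfl <;> simp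
        rcases hab with h | h <;> rw [h]
        · refine ⟨by simpa using hsum i j, ?_⟩
          convert M.add_mem (hδε i) (hsub hij.le) using 1
          module
        · refine ⟨by simpa [sub_eq_add_neg] using hsub hij.le, ?_⟩
          convert M.add_mem (hδε i) (hsum i j) using 1
          module
      refine key hαM.1 hαM.2 ha m ?_
      rw [hx]
      rcases ha with rfl | rfl <;> module
end
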